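/- Let n = qk + r with 0 ≤ r < k and k ≥ 3. The number of arcs of F^{q+1}_{n,k} equals n²/2 + ((k−2)/2)n − r(k−r)/2, which equals the maximum number of arcs of a digraph on n vertices containing no directed cycle of length k+1. -/

import Mathlib

open Finset

/-- Index of the part containing vertex `v` in `F^{q+1}_{n,k}`:
`q` parts of size `k` followed by one part of size `r`. -/
def partIdxQ (k q v : ℕ) : ℕ := if v < q * k then v / k else q

/-- Number of arcs of `F^{q+1}_{n,k}` (arc `u → v` iff `u ≠ v` and the part of `u`
is not later than the part of `v`). -/
def FArcCount (n k q : ℕ) : ℕ :=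
  (univ.filter fun p : Fin n × Fin n =>
    p.1 ≠ p.2 ∧ partIdxQ k q ↑p.1 ≤ partIdxQ k q ↑p.2).card

section DirectedTuran

lemma ite_add_ite_le_one {p q : Prop} [Decidable p] [Decidable q] (h : ¬ (p ∧ q)) :
    (if p then 1 else 0) + (if q then 1 else 0) ≤ 1 := by
  split_ifs <;> simp_all

variable {α : Type*} (D : α → α → Prop)

/-- The digraph `D` has a directed cycle of length `m` with all its vertices in `s`. -/
def HasDirectedCycle (s : Finset α) (m : ℕ) : Prop :=
  ∃ c : ℕ → α, (∀ i, i < m → D (c i) (c (i + 1))) ∧ c m = c 0 ∧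
    (∀ i j, i < m → j < m → c i = c j → i = j) ∧ ∀ i, i < m → c i ∈ s

variable {D} in
lemma HasDirectedCycle.mono {s t : Finset α} {m : ℕ} (h : HasDirectedCycle D s m) (hst : s ⊆ t) :
    HasDirectedCycle D t m := by
  obtain ⟨c, h₁, h₂, h₃, h₄⟩ := h
  exact ⟨c, h₁, h₂, h₃, fun i hi => hst (h₄ i hi)⟩

lemma hasDirectedCycle_two {s : Finset α} {u v : α} (hu : u ∈ s) (hv : v ∈ s) (huv : u ≠ v)
    (h₁ : D u v) (h₂ : D v u) : HasDirectedCycle D s 2 := by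
  refine ⟨fun i => if i = 1 then v else u, ?_, by simp, ?_, ?_⟩
  · intro i hi
    interval_cases i <;> simp [h₁, h₂]
  · intro i j hi hj
    interval_cases i <;> interval_cases j <;> simp [huv, huv.symm]
  · intro i hi
    interval_cases i <;> simp [hu, hv]

/-- A vertex off a `k`-cycle that can be inserted between two consecutive vertices of the cycle
yields a `(k + 1)`-cycle. -/
lemma hasDirectedCycle_succ {s : Finset α} {k : ℕ} {c : ℕ → α}
    (h₁ : ∀ i, i < k → D (c i) (c (i + 1))) (h₂ : c k = c 0)
    (h₃ : ∀ i j, i < k → j < k → c i = c j → i = j) (h₄ : ∀ i, i < k → c i ∈ s)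
    {v : α} (hv : v ∈ s) (hvc : ∀ i, i < k → c i ≠ v) {i : ℕ} (hi : i < k)
    (hiv : D (c i) v) (hvi : D v (c (i + 1))) : HasDirectedCycle D s (k + 1) := by
  have hk : 0 < k := by omega
  have hstep : ∀ j, D (c (j % k)) (c ((j + 1) % k)) := by
    intro j
    have hj := Nat.mod_lt j hk
    rw [← Nat.mod_add_mod]
    rcases Nat.lt_or_ge (j % k + 1) k with h | h
    · rw [Nat.mod_eq_of_lt h]
      exact h₁ _ hj
    · have h' : j % k + 1 = k := by omega
      rw [h', Nat.mod_self, ← h₂]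
      conv_rhs => rw [← h']
      exact h₁ _ hj
  have hsucc : c ((i + 1) % k) = c (i + 1) := by
    rcases Nat.lt_or_ge (i + 1) k with h | h
    · rw [Nat.mod_eq_of_lt h]
    · rw [show i + 1 = k by omega, Nat.mod_self, h₂]
  have hinj : ∀ a b, a < k → b < k → c ((i + 1 + a) % k) = c ((i + 1 + b) % k) → a = b := by
    intro a b ha hb hab
    have h := h₃ _ _ (Nat.mod_lt _ hk) (Nat.mod_lt _ hk) hab
    have h' : a ≡ b [MOD k] := Nat.ModEq.add_left_cancel' (i + 1) h
    exact Nat.ModEq.eq_of_lt_of_lt h' ha hb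
  refine ⟨fun j => if j = k then v else if j = k + 1 then c ((i + 1) % k)
    else c ((i + 1 + j) % k), ?_, ?_, ?_, ?_⟩
  · intro j hj
    rcases eq_or_ne j k with rfl | hjk
    · simpa [hsucc] using hvi
    rcases eq_or_ne (j + 1) k with hjk' | hjk'
    · have : (i + 1 + j) % k = i := by
        rw [show i + 1 + j = i + k by omega, Nat.add_mod_right, Nat.mod_eq_of_lt hi]
      simpa [hjk, hjk', this, show j ≠ k + 1 by omega] using hiv
    · simpa [hjk, hjk', show j ≠ k + 1 by omega, add_assoc] using hstep (i + 1 + j)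
  · simp [hk.ne]
  · intro a b ha hb
    rcases eq_or_ne a k with rfl | hak <;> rcases eq_or_ne b a with rfl | hbk
    · simp
    · simpa [hbk, hb.ne] using fun h => absurd h.symm (hvc _ (Nat.mod_lt _ hk))
    · simp
    · rcases eq_or_ne b k with rfl | hbk
      · simpa [hak, ha.ne] using fun h => absurd h (hvc _ (Nat.mod_lt _ hk))
      · simpa [hak, hbk, ha.ne, hb.ne] using hinj a b (by omega) (by omega)
  · intro j hj
    rcases eq_or_ne j k with rfl | hjk
    · simpa using hv
    · simpa [hjk, hj.ne] using h₄ _ (Nat.mod_lt _ hk)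

/-- The number of arcs of the extremal digraph, adding its vertices one at a time. -/
def turanArcSum (k n : ℕ) : ℕ := ∑ i ∈ range n, (i + i % k)

lemma turanArcSum_succ (k n : ℕ) : turanArcSum k (n + 1) = turanArcSum k n + (n + n % k) :=
  sum_range_succ _ _

lemma turanArcSum_self_of_le {k n : ℕ} (h : n ≤ k) : turanArcSum k n = n * n - n := by
  induction n with
  | zero => simp [turanArcSum]
  | succ n ih =>
    rw [turanArcSum_succ, ih (by omega), Nat.mod_eq_of_lt (by omega)]
    have := Nat.le_mul_self n
    zify [this, Nat.le_mul_self (n + 1)]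
    ring

lemma turanArcSum_add (k n : ℕ) :
    turanArcSum k (n + k) = turanArcSum k n + k * n + (k * k - k) := by
  rw [turanArcSum, add_comm n k, sum_range_add, ← turanArcSum, turanArcSum_self_of_le le_rfl]
  have h : ∀ i, k + i + (k + i) % k = i + i % k + k := fun i => by
    rw [Nat.add_mod_left]
    ring
  simp only [h, sum_add_distrib (g := fun _ => k), sum_const, card_range, smul_eq_mul]
  rw [← turanArcSum]
  ring

lemma turanArcSum_le_succ {k : ℕ} (hk : 0 < k) (n : ℕ) :
    turanArcSum k n ≤ turanArcSum (k + 1) n := by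
  induction n using Nat.strong_induction_on with
  | _ n ih =>
    rcases Nat.lt_or_ge n (k + 1) with h | h
    · rw [turanArcSum_self_of_le (Nat.lt_succ_iff.mp h), turanArcSum_self_of_le h.le]
    · obtain ⟨m, rfl⟩ := Nat.exists_eq_add_of_le' h
      have := ih m (by omega)
      rw [turanArcSum_add, show m + (k + 1) = m + 1 + k by ring, turanArcSum_add, turanArcSum_succ]
      have hm := Nat.mod_lt m hk
      zify [Nat.le_mul_self k, Nat.le_mul_self (k + 1)] at *
      nlinarith

lemma two_mul_turanArcSum {k q r : ℕ} (hk : 2 ≤ k) (hrk : r < k) :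
    2 * turanArcSum k (q * k + r) + r * (k - r) =
      (q * k + r) ^ 2 + (k - 2) * (q * k + r) := by
  induction q with
  | zero =>
    rw [zero_mul, zero_add, turanArcSum_self_of_le hrk.le]
    zify [Nat.le_mul_self r, hrk.le, hk]
    ring
  | succ q ih =>
    rw [show (q + 1) * k + r = q * k + r + k by ring, turanArcSum_add]
    zify [Nat.le_mul_self k, hrk.le, hk] at *
    linear_combination ih

variable [DecidableRel D]

/-- Number of arcs of the digraph `D` spanned by `s`. -/
def arcCount (s : Finset α) : ℕ := ∑ u ∈ s, ∑ v ∈ s, if D u v then 1 else 0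

lemma arcCount_eq_card (s : Finset α) :
    arcCount D s = ((s ×ˢ s).filter fun p => D p.1 p.2).card := by
  rw [arcCount, card_filter, sum_product]

lemma arcCount_union [DecidableEq α] {s t : Finset α} (h : Disjoint s t) :
    arcCount D (s ∪ t) = arcCount D s + arcCount D t +
      ∑ v ∈ t, ∑ u ∈ s, ((if D u v then 1 else 0) + (if D v u then 1 else 0)) := by
  simp only [arcCount, sum_union h, sum_add_distrib]
  rw [sum_comm (s := s) (t := t)]
  ring

lemma arcCount_insert [DecidableEq α] (hD : ∀ v, ¬ D v v) {s : Finset α} {a : α} (ha : a ∉ s) :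
    arcCount D (insert a s) = arcCount D s +
      ∑ u ∈ s, ((if D u a then 1 else 0) + (if D a u then 1 else 0)) := by
  rw [insert_eq, union_comm, arcCount_union D (by simpa using ha)]
  simp [arcCount, hD]

lemma arcCount_le (hD : ∀ v, ¬ D v v) (s : Finset α) :
    arcCount D s ≤ s.card * s.card - s.card := by
  classical
  rw [arcCount_eq_card, ← offDiag_card]
  refine card_le_card fun p hp => ?_
  simp only [mem_filter, mem_product] at hp
  rw [mem_offDiag]
  exact ⟨hp.1.1, hp.1.2, fun h => hD p.2 (h ▸ hp.2)⟩

lemma arcCount_le_turanArcSum_one (hD : ∀ v, ¬ D v v) (s : Finset α)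
    (h : ¬ HasDirectedCycle D s 2) : arcCount D s ≤ turanArcSum 1 s.card := by
  classical
  induction s using Finset.induction_on with
  | empty => simp [arcCount]
  | insert a s ha ih =>
    rw [arcCount_insert D hD ha, card_insert_of_notMem ha, turanArcSum_succ, Nat.mod_one]
    refine add_le_add (ih fun h' => h (h'.mono (subset_insert a s))) ?_
    rw [add_zero, card_eq_sum_ones]
    refine sum_le_sum fun u hu => ?_
    exact ite_add_ite_le_one fun hua => h <| hasDirectedCycle_two D
      (mem_insert_of_mem hu) (mem_insert_self a s) (fun e => ha (e ▸ hu)) hua.1 hua.2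

/-- A digraph without directed `(k + 1)`-cycle has at most as many arcs as the extremal one. -/
theorem arcCount_le_turanArcSum (hD : ∀ v, ¬ D v v) {k : ℕ} (hk : 1 ≤ k) (s : Finset α)
    (h : ¬ HasDirectedCycle D s (k + 1)) : arcCount D s ≤ turanArcSum k s.card := by
  classical
  induction k, hk using Nat.le_induction generalizing s with
  | base => exact arcCount_le_turanArcSum_one D hD s h
  | succ k hk ihk =>
    induction s using Finset.strongInduction with
    | _ s ihs =>
      by_cases hc : HasDirectedCycle D s (k + 1)
      swap
      · exact (ihk s hc).trans (turanArcSum_le_succ hk _)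
      obtain ⟨c, h₁, h₂, h₃, h₄⟩ := hc
      have hinj : Set.InjOn c (range (k + 1)) := fun i hi j hj =>
        h₃ i j (by simpa using hi) (by simpa using hj)
      set C := (range (k + 1)).image c with hC
      have hCs : C ⊆ s := image_subset_iff.2 fun i hi => h₄ i (mem_range.1 hi)
      have hcard : C.card = k + 1 := by rw [hC, card_image_of_injOn hinj, card_range]
      have hss : s \ C ⊂ s := sdiff_ssubset hCs (card_pos.1 (by omega))
      have hrest := ihs (s \ C) hss fun h' => h (h'.mono hss.subset)
      have hcross : ∑ v ∈ s \ C, ∑ u ∈ C,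
          ((if D u v then 1 else 0) + (if D v u then 1 else 0)) ≤ (s \ C).card * (k + 1) := by
        rw [← smul_eq_mul]
        refine sum_le_card_nsmul _ _ _ fun v hv => ?_
        obtain ⟨hvs, hvC⟩ := mem_sdiff.1 hv
        have hvc : ∀ i, i < k + 1 → c i ≠ v := fun i hi e =>
          hvC (e ▸ mem_image_of_mem c (mem_range.2 hi))
        have hshift : ∑ i ∈ range (k + 1), (if D v (c i) then 1 else 0) =
            ∑ i ∈ range (k + 1), (if D v (c (i + 1)) then 1 else 0) := by
          have := sum_range_succ (fun i => if D v (c i) then 1 else 0) (k + 1)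
          rw [sum_range_succ', h₂] at this
          exact (Nat.add_right_cancel this).symm
        rw [hC, sum_image hinj, sum_add_distrib, hshift, ← sum_add_distrib]
        refine (sum_le_card_nsmul _ _ 1 fun i hi => ?_).trans (by simp)
        exact ite_add_ite_le_one fun h' => h <|
          hasDirectedCycle_succ D h₁ h₂ h₃ h₄ hvs hvc (mem_range.1 hi) h'.1 h'.2
      have hin := arcCount_le D hD C
      rw [hcard] at hin
      have hsum := arcCount_union D (disjoint_sdiff (s := C) (t := s))
      rw [union_sdiff_of_subset hCs] at hsum
      have hs : s.card = (s \ C).card + (k + 1) := by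
        rw [← hcard, card_sdiff_add_card_eq_card hCs]
      rw [hsum, hs, turanArcSum_add]
      rw [mul_comm] at hcross
      omega

end DirectedTuran

lemma partIdxQ_eq_div {k q r v : ℕ} (hrk : r < k) (hv : v < q * k + r) :
    partIdxQ k q v = v / k := by
  unfold partIdxQ
  split_ifs with h
  · rfl
  · exact (Nat.div_eq_of_lt_le (by omega) (by rw [add_mul]; omega)).symm

/-- The digraph on `ℕ` whose parts are the consecutive blocks of length `k`. -/
lemma arcCount_blocks {k : ℕ} (hk : 0 < k) (n : ℕ) :
    arcCount (fun u v : ℕ => u ≠ v ∧ u / k ≤ v / k) (range n) = turanArcSum k n := by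
  induction n with
  | zero => simp [arcCount, turanArcSum]
  | succ n ih =>
    rw [range_add_one, arcCount_insert _ (by simp) (by simp), ih, turanArcSum_succ,
      sum_add_distrib]
    congr 2
    · rw [← card_filter, filter_true_of_mem, card_range]
      intro u hu
      exact ⟨(mem_range.1 hu).ne, Nat.div_le_div_right (mem_range.1 hu).le⟩
    · have hmod := Nat.mod_add_div' n k
      have : (range n).filter (fun u => n ≠ u ∧ n / k ≤ u / k) = Ico (n / k * k) n := by
        ext u
        simp only [mem_filter, mem_range, mem_Ico, Nat.le_div_iff_mul_le hk]
        omega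
      rw [← card_filter, this, Nat.card_Ico]
      omega

lemma FArcCount_eq {n k q r : ℕ} (hqr : n = q * k + r) (hrk : r < k) :
    FArcCount n k q = turanArcSum k n := by
  rw [← arcCount_blocks (by omega), arcCount, FArcCount, card_filter, ← univ_product_univ,
    sum_product, ← Fin.sum_univ_eq_sum_range]
  refine sum_congr rfl fun u _ => ?_
  rw [← Fin.sum_univ_eq_sum_range]
  refine sum_congr rfl fun v _ => ?_
  rw [partIdxQ_eq_div hrk (hqr ▸ u.2), partIdxQ_eq_div hrk (hqr ▸ v.2)]
  simp only [ne_eq, Fin.ext_iff]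

theorem F_arc_count_and_turan (n k q r : ℕ) (hk : 3 ≤ k)
    (hqr : n = q * k + r) (hrk : r < k) :
    2 * FArcCount n k q + r * (k - r) = n ^ 2 + (k - 2) * n ∧
    IsGreatest {m : ℕ | ∃ D : Fin n → Fin n → Bool,
        (∀ v, D v v = false) ∧
        (¬ ∃ c : ℕ → Fin n, (∀ i, i < k + 1 → D (c i) (c (i + 1)) = true) ∧
          c (k + 1) = c 0 ∧ (∀ i j, i < k + 1 → j < k + 1 → c i = c j → i = j)) ∧
        m = (univ.filter fun p : Fin n × Fin n => D p.1 p.2 = true).card}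
      (FArcCount n k q) := by
  refine ⟨?_, ⟨fun u v => decide (u ≠ v ∧ partIdxQ k q u ≤ partIdxQ k q v), by simp, ?_,
    by simp [FArcCount]⟩, ?_⟩
  · rw [FArcCount_eq hqr hrk, hqr]
    exact two_mul_turanArcSum (by omega) hrk
  · rintro ⟨c, h₁, h₂, h₃⟩
    have hstep : ∀ i, i < k + 1 → (c i : ℕ) / k ≤ (c (i + 1) : ℕ) / k := by
      intro i hi
      have h := (of_decide_eq_true (h₁ i hi)).2
      rwa [partIdxQ_eq_div hrk (hqr ▸ (c i).2), partIdxQ_eq_div hrk (hqr ▸ (c (i + 1)).2)] at h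
    have hle : ∀ j, j ≤ k + 1 → ∀ i, i ≤ j → (c i : ℕ) / k ≤ (c j : ℕ) / k := by
      intro j hj i hij
      induction j, hij using Nat.le_induction with
      | base => rfl
      | succ j _ ih => exact (ih (by omega)).trans (hstep j (by omega))
    have hconst : ∀ i, i < k + 1 → (c i : ℕ) / k = (c 0 : ℕ) / k := fun i hi =>
      le_antisymm (h₂ ▸ hle (k + 1) le_rfl i hi.le) (hle i hi.le 0 (Nat.zero_le i))
    obtain ⟨i, hi, j, hj, hij, hmod⟩ := exists_ne_map_eq_of_card_lt_of_maps_to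
      (s := range (k + 1)) (t := range k) (f := fun i => (c i : ℕ) % k) (by simp)
      (fun i _ => by simpa using Nat.mod_lt _ (by omega))
    rw [mem_range] at hi hj
    refine hij (h₃ i j hi hj (Fin.ext ?_))
    rw [← Nat.div_add_mod (c i : ℕ) k, ← Nat.div_add_mod (c j : ℕ) k, hconst i hi, hconst j hj]
    exact congrArg _ hmod
  · rintro m ⟨D, hD, hc, rfl⟩
    have h := arcCount_le_turanArcSum (fun u v => D u v = true) (by simp [hD]) (by omega : 1 ≤ k)
      univ fun ⟨c, h₁, h₂, h₃, _⟩ => hc ⟨c, h₁, h₂, h₃⟩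
    rwa [arcCount_eq_card, univ_product_univ, card_univ, Fintype.card_fin,
      ← FArcCount_eq hqr hrk] at h
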